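/- For a cyclic sequence (i_1,...,i_m) of elements of {1,...,q} with i_j ≠ i_{j+1} for all j (indices mod m), let π be the partition of {1,...,m} where j ~ l iff i_j = i_l, and let σ = (i_1,i_2)(i_2,i_3)···(i_{m-1},i_m)(i_m,i_1) ∈ S_q. If π is noncrossing, then the Cayley length |σ| (minimal number of transpositions needed to write σ) equals m − 2|K(π)|, where K(π) is the Kreweras complement of π. -/

import Mathlib

open Finset

/-- `x` and `y` lie in the same block of the partition `π`. -/
def SameBlock {α : Type*} [DecidableEq α] {s : Finset α} (π : Finpartition s)
    (x y : α) : Prop :=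
  ∃ B ∈ π.parts, x ∈ B ∧ y ∈ B

/-- A partition of `{1,…,n}` (modelled on `Fin n`) is noncrossing if whenever
`a < b < c < d` with `a,c` in one block and `b,d` in one block, all four lie in a
common block. -/
def Noncrossing {n : ℕ} (π : Finpartition (univ : Finset (Fin n))) : Prop :=
  ∀ a b c d : Fin n, a < b → b < c → c < d →
    SameBlock π a c → SameBlock π b d → SameBlock π a b

/-- The position of a point in the interleaved sequence `1,1',2,2',…,n,n'`:
`(i, false)` is the point `i+1` and `(i, true)` is the primed point `(i+1)'`. -/
def interPos {n : ℕ} (x : Fin n × Bool) : ℕ :=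
  2 * x.1.val + (if x.2 then 1 else 0)

/-- Same-block relation for the union of a partition `π` of the unprimed points with a
partition `κ` of the primed points. -/
def UnionRel {n : ℕ} (π κ : Finpartition (univ : Finset (Fin n)))
    (x y : Fin n × Bool) : Prop :=
  x.2 = y.2 ∧ (if x.2 = true then SameBlock κ x.1 y.1 else SameBlock π x.1 y.1)

/-- `π ∪ κ` is a noncrossing partition of the interleaved points `1,1',2,2',…,n,n'`. -/
def UnionNoncrossing {n : ℕ} (π κ : Finpartition (univ : Finset (Fin n))) : Prop :=
  ∀ a b c d : Fin n × Bool,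
    interPos a < interPos b → interPos b < interPos c → interPos c < interPos d →
    UnionRel π κ a c → UnionRel π κ b d → UnionRel π κ a b

/-- `κ` is the Kreweras complement of `π`: it is the maximal partition of the primed
points `1',…,n'` such that `π ∪ κ` is noncrossing on the interleaved points. -/
def IsKreweras {n : ℕ} (π κ : Finpartition (univ : Finset (Fin n))) : Prop :=
  UnionNoncrossing π κ ∧
    ∀ κ' : Finpartition (univ : Finset (Fin n)), UnionNoncrossing π κ' → κ' ≤ κ

/-- The Cayley length of a permutation: the minimal number of transpositions needed to
express it as a product. -/
noncomputable def cayleyLength {α : Type*} [DecidableEq α] (σ : Equiv.Perm α) : ℕ :=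
  sInf {l | ∃ L : List (Equiv.Perm α), L.length = l ∧
    (∀ τ ∈ L, ∃ a b, a ≠ b ∧ τ = Equiv.swap a b) ∧ L.prod = σ}

/-- The kernel partition of a sequence `i : Fin m → Fin q`: positions `j, l` are in the
same block iff `i j = i l`. -/
def kernelPartition {m q : ℕ} (i : Fin m → Fin q) :
    Finpartition (univ : Finset (Fin m)) :=
  @Finpartition.ofSetoid (Fin m) _ _ (Setoid.ker i)
    (fun a b => inferInstanceAs (Decidable (i a = i b)))

/-- The cyclic product of transpositions `(i₁ i₂)(i₂ i₃)⋯(i_{m-1} i_m)(i_m i₁)`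
associated with the sequence `i`. -/
def cyclicProd {m q : ℕ} (i : Fin m → Fin q) : Equiv.Perm (Fin q) :=
  ((List.finRange m).map fun j => Equiv.swap (i j) (i (finRotate m j))).prod


section Words
variable {α : Type*} [DecidableEq α]

/-- Product of the transpositions along a walk. -/
def walkProd : List α → Equiv.Perm α
  | a :: b :: l => Equiv.swap a b * walkProd (b :: l)
  | _ => 1

theorem walkProd_append (A : List α) (a : α) (C : List α) :
    walkProd (A ++ a :: C) = walkProd (A ++ [a]) * walkProd (a :: C) := by
  induction A with
  | nil => simp [walkProd]
  | cons x A ih =>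
    cases A with
    | nil => simp [walkProd]
    | cons y A =>
      simp only [List.cons_append, walkProd] at ih ⊢
      rw [ih, mul_assoc]

theorem walkProd_fix (w : List α) (x : α) (hx : x ∉ w) : walkProd w x = x := by
  induction w with
  | nil => simp [walkProd]
  | cons a w ih =>
    cases w with
    | nil => simp [walkProd]
    | cons b w =>
      simp only [List.mem_cons, not_or] at hx ih
      simp only [walkProd, Equiv.Perm.mul_apply]
      rw [ih hx.2, Equiv.swap_apply_of_ne_of_ne hx.1 hx.2.1]

/-- functions invariant under a permutation -/
def fixSpace (σ : Equiv.Perm α) : Submodule ℚ (α → ℚ) where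
  carrier := {v | ∀ z, v (σ z) = v z}
  add_mem' := by
    intro a b ha hb z
    simp [ha z, hb z]
  zero_mem' := by intro z; rfl
  smul_mem' := by
    intro c a ha z
    simp [ha z]

theorem mem_fixSpace (σ : Equiv.Perm α) (v : α → ℚ) :
    v ∈ fixSpace σ ↔ ∀ z, v (σ z) = v z := Iff.rfl

variable [Fintype α]

theorem finrank_le_swap (σ : Equiv.Perm α) (a b : α) :
    Module.finrank ℚ (fixSpace σ) ≤ Module.finrank ℚ (fixSpace (Equiv.swap a b * σ)) + 1 := by
  let φ : fixSpace σ →ₗ[ℚ] ℚ :=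
    ((LinearMap.proj (R := ℚ) (φ := fun _ : α => ℚ) a - LinearMap.proj (R := ℚ) (φ := fun _ : α => ℚ) b)).comp (fixSpace σ).subtype
  have h1 := φ.finrank_range_add_finrank_ker
  have h2 : Module.finrank ℚ (LinearMap.range φ) ≤ 1 := by
    have := Submodule.finrank_le (LinearMap.range φ)
    simpa using this
  have h3 : Module.finrank ℚ (LinearMap.ker φ) ≤
      Module.finrank ℚ (fixSpace (Equiv.swap a b * σ)) := by
    rw [← Submodule.finrank_map_subtype_eq (fixSpace σ) (LinearMap.ker φ)]
    apply Submodule.finrank_mono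
    rintro v ⟨⟨u, hu⟩, hk, rfl⟩
    have hk' : u a = u b := by
      have : φ ⟨u, hu⟩ = 0 := hk
      simpa [φ, sub_eq_zero] using this
    intro z
    show u (Equiv.swap a b (σ z)) = u z
    rw [← hu z]
    rcases eq_or_ne (σ z) a with h | h
    · rw [h, Equiv.swap_apply_left, hk']
    · rcases eq_or_ne (σ z) b with h' | h'
      · rw [h', Equiv.swap_apply_right, hk']
      · rw [Equiv.swap_apply_of_ne_of_ne h h']
  omega

theorem word_lower (L : List (Equiv.Perm α))
    (hL : ∀ τ ∈ L, ∃ a b, a ≠ b ∧ τ = Equiv.swap a b) :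
    Fintype.card α ≤ Module.finrank ℚ (fixSpace L.prod) + L.length := by
  induction L with
  | nil =>
    have : fixSpace (1 : Equiv.Perm α) = ⊤ := by
      ext v; simp [mem_fixSpace]
    change Fintype.card α ≤ Module.finrank ℚ (fixSpace (1 : Equiv.Perm α)) + 0
    rw [this]
    simp
  | cons t L ih =>
    obtain ⟨a, b, -, rfl⟩ := hL t (by simp)
    have := ih (fun τ h => hL τ (by simp [h]))
    have h2 := finrank_le_swap L.prod a b
    change _ ≤ Module.finrank ℚ (fixSpace (Equiv.swap a b * L.prod)) + (L.length + 1)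
    omega

/-- certificate for the Cayley length -/
def Good (σ : Equiv.Perm α) (k : ℕ) : Prop :=
  (∃ L : List (Equiv.Perm α), L.length = k ∧
    (∀ τ ∈ L, ∃ a b, a ≠ b ∧ τ = Equiv.swap a b) ∧ L.prod = σ) ∧
  Module.finrank ℚ (fixSpace σ) + k ≤ Fintype.card α

theorem Good.length {σ : Equiv.Perm α} {k : ℕ} (h : Good σ k) : cayleyLength σ = k := by
  unfold cayleyLength
  apply le_antisymm
  · exact Nat.sInf_le h.1
  · apply le_csInf ⟨k, h.1⟩
    rintro l ⟨L, rfl, hL, rfl⟩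
    have := word_lower L hL
    have := h.2
    omega

theorem good_one : Good (1 : Equiv.Perm α) 0 := by
  refine ⟨⟨[], by simp⟩, ?_⟩
  have := Submodule.finrank_le (fixSpace (1 : Equiv.Perm α))
  simpa using this

theorem Good.mul_swap {σ : Equiv.Perm α} {k : ℕ} (h : Good σ k) {x y : α} (hx : σ x = x)
    (hy : y ≠ x) : Good (σ * Equiv.swap y x) (k + 1) := by
  obtain ⟨⟨L, hl, hL, hp⟩, hr⟩ := h
  refine ⟨⟨L ++ [Equiv.swap y x], by simp [hl], ?_, by simp [hp]⟩, ?_⟩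
  · intro τ hτ
    rcases List.mem_append.1 hτ with h | h
    · exact hL τ h
    · exact ⟨y, x, hy, by simpa using h⟩
  · have hlt : fixSpace (σ * Equiv.swap y x) < fixSpace σ := by
      have key : ∀ v ∈ fixSpace (σ * Equiv.swap y x), v x = v y := by
        intro v hv
        have := hv y
        simpa [hx] using this
      refine lt_of_le_of_ne ?_ ?_
      · intro v hv z
        have hxy := key v hv
        have h1 := hv (Equiv.swap y x z)
        simp only [Equiv.Perm.mul_apply, Equiv.swap_apply_self] at h1
        rw [h1]
        rcases eq_or_ne z y with h | h
        · rw [h, Equiv.swap_apply_left, hxy]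
        · rcases eq_or_ne z x with h' | h'
          · rw [h', Equiv.swap_apply_right, hxy]
          · rw [Equiv.swap_apply_of_ne_of_ne h h']
      · intro he
        have hm : (Pi.single x 1 : α → ℚ) ∈ fixSpace σ := by
          intro z
          rcases eq_or_ne z x with h | h
          · rw [h, hx]
          · have : σ z ≠ x := fun h' => h (σ.injective (h'.trans hx.symm))
            simp [Pi.single_apply, h, this]
        rw [← he] at hm
        have := key _ hm
        simp [Pi.single_apply, hy] at this
    have := Submodule.finrank_lt_finrank_of_lt hlt
    omega

end Words

section Walks
variable {α : Type*} [DecidableEq α]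

theorem exists_leaf (w : List α) (hc : w.IsChain (· ≠ ·))
    (hn : ∀ a b, [a, b, a, b].Sublist w → a = b) (hd : ¬ w.Nodup) :
    ∃ A a x b B, w = A ++ a :: x :: b :: B ∧ x ∉ A ∧ x ≠ a ∧ x ≠ b ∧ x ∉ B := by
  have hex : ∃ k, ∃ A a C B, w = A ++ a :: (C ++ a :: B) ∧ C.length = k := by
    obtain ⟨a, ha⟩ := List.exists_duplicate_iff_not_nodup.2 hd
    rw [List.duplicate_iff_sublist] at ha
    have h1 : a ∈ w := ha.subset (by simp)
    obtain ⟨A, D, hw, hA⟩ := List.eq_append_cons_of_mem h1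
    have h2 : a ∈ D := by
      by_contra hD
      have := ha.count_le a
      rw [hw] at this
      simp [List.count_append, List.count_eq_zero_of_not_mem hA,
        List.count_eq_zero_of_not_mem hD] at this
    obtain ⟨C, B, hD, -⟩ := List.eq_append_cons_of_mem h2
    exact ⟨_, A, a, C, B, by rw [hw, hD], rfl⟩
  classical
  obtain ⟨A, a, C, B, hw, hC⟩ := Nat.find_spec hex
  have hmin := fun j => Nat.find_min hex (m := j)
  rw [← hC] at hmin
  clear hC
  cases C with
  | nil =>
    exfalso
    subst hw
    simp [List.isChain_append] at hc
  | cons x C =>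
    have hxa : x ≠ a := by
      rintro rfl
      subst hw
      simp [List.isChain_append] at hc
    have hxC : x ∉ C := by
      intro h
      obtain ⟨D, E, hDE, -⟩ := List.eq_append_cons_of_mem h
      refine hmin D.length (by simp [hDE]) ⟨A ++ [a], x, D, E ++ a :: B, ?_, rfl⟩
      rw [hw, hDE]; simp
    have hxA : x ∉ A := by
      intro h
      apply hxa
      apply hn
      rw [hw]
      have h1 : [x].Sublist A := by simpa using h
      have h2 := h1.append (show [a, x, a].Sublist (a :: (x :: C ++ a :: B)) by simp)
      simpa using h2
    have hxB : x ∉ B := by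
      intro h
      apply hxa
      symm
      apply hn
      rw [hw]
      have h1 : [x].Sublist B := by simpa using h
      refine List.Sublist.trans ?_ (List.sublist_append_right _ _)
      simp only [List.cons_append, List.cons_sublist_cons]
      refine List.Sublist.trans ?_ (List.sublist_append_right _ _)
      simpa using h
    cases C with
    | nil => exact ⟨A, a, x, a, B, by simpa using hw, hxA, hxa, hxa, hxB⟩
    | cons b C =>
      simp only [List.mem_cons, not_or] at hxC
      refine ⟨A, a, x, b, C ++ a :: B, by simpa using hw, hxA, hxa, hxC.1, ?_⟩
      simp [hxC.2, hxa, hxB]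

theorem walk_good [Fintype α] (n : ℕ) : ∀ (w : List α), w.length = n → w ≠ [] →
    w.IsChain (· ≠ ·) → (∀ a b, [a, b, a, b].Sublist w → a = b) → w.head? = w.getLast? →
    ∃ k, Good (walkProd w) k ∧ k + w.length + 1 = 2 * w.toFinset.card := by
  induction n using Nat.strong_induction_on with
  | _ n ih =>
  intro w hlen hne hc hn hcl
  by_cases hd : w.Nodup
  · match w, hne with
    | [a], _ => exact ⟨0, by simpa [walkProd] using good_one, by simp⟩
    | a :: b :: l, _ =>
      exfalso
      have : a ∈ b :: l := by
        rw [List.head?_cons, List.getLast?_cons_cons] at hcl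
        exact List.mem_of_getLast? hcl.symm
      exact (List.nodup_cons.1 hd).1 this
  · obtain ⟨A, a, x, b, B, hw, hxA, hxa, hxb, hxB⟩ := exists_leaf w hc hn hd
    subst hw
    have hP : walkProd (A ++ a :: x :: b :: B) =
        walkProd (A ++ [a]) * (Equiv.swap a x * (Equiv.swap x b * walkProd (b :: B))) := by
      rw [walkProd_append]; rfl
    rcases eq_or_ne a b with hab | hab
    · subst hab
      obtain ⟨k, hk, he⟩ := ih (A ++ a :: B).length (by simp at hlen ⊢; omega) (A ++ a :: B) rfl
        (by simp)
        (by
          simp only [List.isChain_append, List.isChain_cons_cons] at hc ⊢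
          simp_all)
        (fun u v h => hn u v (h.trans (by simp)))
        (by
          simp only [List.head?_append, List.getLast?_append] at hcl ⊢
          simpa using hcl)
      refine ⟨k, ?_, ?_⟩
      · rw [hP, Equiv.swap_comm x a, ← mul_assoc (Equiv.swap a x), Equiv.swap_mul_self, one_mul,
          ← walkProd_append]
        exact hk
      · have : (A ++ a :: x :: a :: B).toFinset = insert x (A ++ a :: B).toFinset := by
          ext z; simp
        rw [this, Finset.card_insert_of_notMem (by simp [hxA, hxa, hxB])]
        simp at he ⊢
        omega
    · obtain ⟨k, hk, he⟩ := ih (A ++ a :: b :: B).length (by simp at hlen ⊢; omega)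
        (A ++ a :: b :: B) rfl
        (by simp)
        (by
          simp only [List.isChain_append, List.isChain_cons_cons] at hc ⊢
          simp_all)
        (fun u v h => hn u v (h.trans (by simp)))
        (by
          simp only [List.head?_append, List.getLast?_append] at hcl ⊢
          simpa using hcl)
      refine ⟨k + 1, ?_, ?_⟩
      · have hBx : walkProd (b :: B) x = x := walkProd_fix _ _ (by simp [hxb, hxB])
        have hy : (walkProd (b :: B))⁻¹ a ≠ x := by
          intro h
          rw [Equiv.Perm.inv_eq_iff_eq, hBx] at h
          exact hxa h.symm
        have := hk.mul_swap (x := x) (walkProd_fix _ _ (by simp [hxA, hxa, hxb, hxB])) hy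
        convert this using 1
        rw [hP, walkProd_append A a (b :: B)]
        have e1 : walkProd (b :: B) * Equiv.swap ((walkProd (b :: B))⁻¹ a) x =
            Equiv.swap a x * walkProd (b :: B) := by
          rw [Equiv.mul_swap_eq_swap_mul, hBx]
          simp
        have e2 : Equiv.swap a x * Equiv.swap x b = Equiv.swap a b * Equiv.swap a x := by
          rw [Equiv.mul_swap_eq_swap_mul]
          simp [Equiv.swap_apply_of_ne_of_ne hab.symm hxb.symm]
        show _ = walkProd (A ++ [a]) * (Equiv.swap a b * walkProd (b :: B)) * _
        rw [mul_assoc, mul_assoc, e1, ← mul_assoc (Equiv.swap a x), e2, mul_assoc]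
      · have : (A ++ a :: x :: b :: B).toFinset = insert x (A ++ a :: b :: B).toFinset := by
          ext z; simp; tauto
        rw [this, Finset.card_insert_of_notMem (by simp [hxA, hxa, hxb, hxB])]
        simp at he ⊢
        omega

theorem walkProd_range (g : ℕ → α) (n : ℕ) : walkProd ((List.range (n + 1)).map g) =
    ((List.range n).map (fun j => Equiv.swap (g j) (g (j + 1)))).prod := by
  induction n with
  | zero => simp [walkProd]
  | succ n ih =>
    rw [List.range_succ (n := n + 1), List.range_succ (n := n)] at *
    simp only [List.map_append, List.map_cons, List.map_nil, List.append_assoc,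
      List.cons_append, List.nil_append] at *
    rw [walkProd_append, ih]
    simp [walkProd]

end Walks

theorem sameBlock_kernel {m q : ℕ} (i : Fin m → Fin q) (a b : Fin m) :
    SameBlock (kernelPartition i) a b ↔ i a = i b := by
  unfold SameBlock kernelPartition
  let : DecidableRel (Setoid.ker i).r := fun a b => inferInstanceAs (Decidable (i a = i b))
  constructor
  · rintro ⟨B, hB, ha, hb⟩
    have h1 := Finpartition.mem_part_ofSetoid_iff_rel (s := Setoid.ker i) (a := a) (b := b)
    have h2 := Finpartition.part_eq_of_mem _ hB ha
    exact h1.1 (h2 ▸ hb)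
  · intro h
    refine ⟨_, Finpartition.part_mem _ |>.2 (mem_univ a), Finpartition.mem_part _ (mem_univ a), ?_⟩
    exact Finpartition.mem_part_ofSetoid_iff_rel.2 h

theorem sameBlock_iff_part {m : ℕ} (κ : Finpartition (univ : Finset (Fin m))) (a b : Fin m) :
    SameBlock κ a b ↔ κ.part a = κ.part b := by
  constructor
  · rintro ⟨B, hB, ha, hb⟩
    rw [κ.part_eq_of_mem hB ha, κ.part_eq_of_mem hB hb]
  · intro h
    exact ⟨κ.part a, κ.part_mem.2 (mem_univ _), κ.mem_part (mem_univ _),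
      h ▸ κ.mem_part (mem_univ _)⟩

/-- The interval between `j` and `l` is a union of level sets of `i`. -/
def Sat {m q : ℕ} (i : Fin m → Fin q) (j l : Fin m) : Prop :=
  ∀ x y, i x = i y → ((x ≤ j ↔ x ≤ l) ↔ (y ≤ j ↔ y ≤ l))

/-- `Sat` as a setoid. -/
def satSetoid {m q : ℕ} (i : Fin m → Fin q) : Setoid (Fin m) where
  r := Sat i
  iseqv := by
    refine ⟨fun j x y h => by simp, fun {j l} h x y e => ?_, fun {j l k} h1 h2 x y e => ?_⟩
    · have := h x y e
      tauto
    · have h1' := h1 x y e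
      have h2' := h2 x y e
      simp only [Fin.le_def] at *
      omega

theorem sameBlock_symm {m : ℕ} {κ : Finpartition (univ : Finset (Fin m))} {a b : Fin m}
    (h : SameBlock κ a b) : SameBlock κ b a := by
  obtain ⟨B, hB, h1, h2⟩ := h
  exact ⟨B, hB, h2, h1⟩

theorem sat_of_union_aux {m q : ℕ} (i : Fin m → Fin q)
    (κ : Finpartition (univ : Finset (Fin m))) (h : UnionNoncrossing (kernelPartition i) κ)
    (j l x y : Fin m) (hjl : SameBlock κ j l) (hx : j < x) (hx' : x ≤ l) (e : i x = i y) :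
    j < y ∧ y ≤ l := by
  by_contra hy
  rw [Fin.lt_def] at hx
  rw [Fin.le_def] at hx'
  rw [Fin.lt_def, Fin.le_def] at hy
  by_cases hyj : y.val ≤ j.val
  · have := h (y, false) (j, true) (x, false) (l, true) (by simp [interPos]; omega)
      (by simp [interPos]; omega) (by simp [interPos]; omega)
      (by simp [UnionRel, sameBlock_kernel, e]) (by simp [UnionRel, hjl])
    simp [UnionRel] at this
  · have := h (j, true) (x, false) (l, true) (y, false) (by simp [interPos]; omega)
      (by simp [interPos]; omega) (by simp [interPos]; omega)
      (by simp [UnionRel, hjl]) (by simp [UnionRel, sameBlock_kernel, e])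
    simp [UnionRel] at this

theorem sat_of_lt {m q : ℕ} (i : Fin m → Fin q) (j l : Fin m) (hjl : j ≤ l)
    (h : ∀ x y, i x = i y → j < x → x ≤ l → j < y ∧ y ≤ l) : Sat i j l := by
  intro x y e
  have h1 := h x y e
  have h2 := h y x e.symm
  simp only [Fin.lt_def, Fin.le_def] at *
  omega

theorem sat_of_union {m q : ℕ} (i : Fin m → Fin q)
    (κ : Finpartition (univ : Finset (Fin m))) (h : UnionNoncrossing (kernelPartition i) κ)
    (j l : Fin m) (hjl : SameBlock κ j l) : Sat i j l := by
  rcases le_total j l with hle | hle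
  · exact sat_of_lt i j l hle fun x y e h1 h2 => sat_of_union_aux i κ h j l x y hjl h1 h2 e
  · exact (satSetoid i).symm (sat_of_lt i l j hle fun x y e h1 h2 =>
      sat_of_union_aux i κ h l j x y (sameBlock_symm hjl) h1 h2 e)

open Classical in
theorem exists_satPart {m q : ℕ} (i : Fin m → Fin q) :
    ∃ κ : Finpartition (univ : Finset (Fin m)), ∀ a b, SameBlock κ a b ↔ Sat i a b := by
  refine ⟨Finpartition.ofSetoid (satSetoid i), fun a b => ?_⟩
  rw [sameBlock_iff_part]
  constructor
  · intro h
    have : b ∈ (Finpartition.ofSetoid (satSetoid i)).part a := by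
      rw [h]; exact Finpartition.mem_part _ (mem_univ b)
    exact Finpartition.mem_part_ofSetoid_iff_rel.1 this
  · intro h
    have h1 : b ∈ (Finpartition.ofSetoid (satSetoid i)).part a :=
      Finpartition.mem_part_ofSetoid_iff_rel.2 h
    exact (Finpartition.part_eq_of_mem _ (Finpartition.part_mem _ |>.2 (mem_univ a)) h1).symm

theorem union_of_sat {m q : ℕ} (i : Fin m → Fin q) (hnc : Noncrossing (kernelPartition i))
    (κ : Finpartition (univ : Finset (Fin m))) (hs : ∀ a b, SameBlock κ a b ↔ Sat i a b) :
    UnionNoncrossing (kernelPartition i) κ := by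
  rintro ⟨a, s⟩ ⟨b, t⟩ ⟨c, s'⟩ ⟨d, t'⟩ h1 h2 h3 ⟨e1, r1⟩ ⟨e2, r2⟩
  simp only at e1 e2
  subst e1 e2
  cases s <;> cases t <;> simp [interPos, UnionRel, hs, sameBlock_kernel] at *
  · have := hnc a b c d h1 h2 h3
    simp only [sameBlock_kernel] at this
    exact this r1 r2
  · have := r2 a c r1
    simp only [Fin.le_def] at this
    omega
  · have := r1 b d r2
    simp only [Fin.le_def] at this
    omega
  · intro x y e
    have k1 := r1 x y e
    have k2 := r2 x y e
    simp only [Fin.le_def, Fin.lt_def] at *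
    omega

theorem kreweras_iff {m q : ℕ} (i : Fin m → Fin q) (hnc : Noncrossing (kernelPartition i))
    (κ : Finpartition (univ : Finset (Fin m))) (hκ : IsKreweras (kernelPartition i) κ)
    (a b : Fin m) : SameBlock κ a b ↔ Sat i a b := by
  refine ⟨sat_of_union i κ hκ.1 a b, fun h => ?_⟩
  obtain ⟨κ', h'⟩ := exists_satPart i
  have hle := hκ.2 κ' (union_of_sat i hnc κ' h')
  obtain ⟨B, hB, ha, hb⟩ := (h' a b).2 h
  obtain ⟨C, hC, hBC⟩ := hle hB
  exact ⟨C, hC, hBC ha, hBC hb⟩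

theorem nonmax_iff {m q : ℕ} (i : Fin m → Fin q) (hnc : Noncrossing (kernelPartition i))
    (j : Fin m) : (∃ l, j < l ∧ Sat i j l) ↔
      ∃ h : j.val + 1 < m, ∀ k, k < ⟨j.val + 1, h⟩ → i k ≠ i ⟨j.val + 1, h⟩ := by
  constructor
  · rintro ⟨l, hjl, hs⟩
    refine ⟨by have := l.2; rw [Fin.lt_def] at hjl; omega, fun k hk e => ?_⟩
    have := hs _ _ e
    simp only [Fin.le_def, Fin.lt_def] at *
    omega
  · rintro ⟨h, hf⟩
    set p : Fin m := ⟨j.val + 1, h⟩ with hp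
    have hne : (univ.filter (fun x => i x = i p)).Nonempty := ⟨p, by simp⟩
    obtain ⟨l, hl, hmax⟩ := Finset.exists_max_image _ id hne
    simp only [mem_filter, mem_univ, true_and, id] at hl hmax
    have hpl : p ≤ l := hmax p rfl
    have hpv : p.val = j.val + 1 := rfl
    refine ⟨l, by rw [Fin.lt_def]; rw [Fin.le_def] at hpl; omega, ?_⟩
    apply sat_of_lt
    · rw [Fin.le_def] at *; omega
    intro x y e h1 h2
    by_cases hxp : i x = i p
    · have hyp : i y = i p := e.symm.trans hxp
      have a1 := hmax y hyp
      have a2 : ¬ y < p := fun hh => hf y hh hyp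
      simp only [Fin.le_def, Fin.lt_def] at *
      omega
    · have b1 : p ≠ x := fun hh => hxp (by rw [hh])
      have b2 : x ≠ l := fun hh => hxp (by rw [hh, hl])
      have b3 : y ≠ p := fun hh => hxp (by rw [e, hh])
      have c1 : p < x := lt_of_le_of_ne (by simp only [Fin.le_def, Fin.lt_def] at *; omega) b1
      have c2 : x < l := lt_of_le_of_ne h2 b2
      constructor
      · by_contra hy
        have c3 : y < p := by simp only [Fin.lt_def] at *; omega
        have := hnc y p x l c3 c1 c2
        simp only [sameBlock_kernel] at this
        exact hf y c3 (this e.symm hl.symm)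
      · by_contra hy
        have := hnc p x l y c1 c2 (not_le.1 hy)
        simp only [sameBlock_kernel] at this
        exact hxp (this hl.symm e).symm

open Classical in
theorem card_parts {m : ℕ} (κ : Finpartition (univ : Finset (Fin m))) :
    κ.parts.card = (univ.filter (fun j : Fin m => ¬ ∃ l, j < l ∧ SameBlock κ j l)).card := by
  symm
  apply Finset.card_bij (fun j _ => κ.part j)
  · intro j _
    exact κ.part_mem.2 (mem_univ _)
  · intro a ha b hb h
    rw [← sameBlock_iff_part] at h
    simp only [mem_filter, mem_univ, true_and, not_exists, not_and] at ha hb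
    rcases lt_trichotomy a b with hh | hh | hh
    · exact absurd h (ha b hh)
    · exact hh
    · exact absurd (sameBlock_symm h) (hb a hh)
  · intro B hB
    have hne := κ.nonempty_of_mem_parts hB
    refine ⟨B.max' hne, ?_, κ.part_eq_of_mem hB (B.max'_mem hne)⟩
    simp only [mem_filter, mem_univ, true_and, not_exists, not_and]
    intro l hl hs
    rw [sameBlock_iff_part, κ.part_eq_of_mem hB (B.max'_mem hne)] at hs
    have : l ∈ B := by rw [hs]; exact κ.mem_part (mem_univ _)
    exact absurd (B.le_max' l this) (not_le.2 hl)

open Classical in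
theorem card_image_first {m q : ℕ} (i : Fin m → Fin q) :
    (univ.image i).card = (univ.filter (fun j : Fin m => ∀ k, k < j → i k ≠ i j)).card := by
  rw [← Finset.card_image_of_injOn (s := univ.filter (fun j : Fin m => ∀ k, k < j → i k ≠ i j))
    (f := i)]
  · congr 1
    ext v
    simp only [mem_image, mem_univ, true_and, mem_filter]
    constructor
    · rintro ⟨a, ha⟩
      have hne : (univ.filter (fun x => i x = v)).Nonempty := ⟨a, by simp [ha]⟩
      obtain ⟨l, hl, hmin⟩ := Finset.exists_min_image _ id hne
      simp only [mem_filter, mem_univ, true_and, id] at hl hmin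
      refine ⟨l, fun k hk e => ?_, hl⟩
      exact absurd (hmin k (e.trans hl)) (not_le.2 hk)
    · rintro ⟨a, -, ha⟩
      exact ⟨a, ha⟩
  · intro a ha b hb h
    simp only [coe_filter, Set.mem_setOf_eq, mem_univ, true_and] at ha hb
    rcases lt_trichotomy a b with hh | hh | hh
    · exact absurd h (hb a hh)
    · exact hh
    · exact absurd h.symm (ha b hh)

open Classical in
theorem card_kreweras {m q : ℕ} (hm : 0 < m) (i : Fin m → Fin q)
    (hnc : Noncrossing (kernelPartition i))
    (κ : Finpartition (univ : Finset (Fin m))) (hκ : IsKreweras (kernelPartition i) κ) :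
    κ.parts.card + (univ.image i).card = m + 1 := by
  rw [card_parts, card_image_first]
  simp only [kreweras_iff i hnc κ hκ, nonmax_iff i hnc]
  have h1 := Finset.card_filter_add_card_filter_not (s := (univ : Finset (Fin m)))
    (fun j => ∃ h : j.val + 1 < m, ∀ k, k < ⟨j.val + 1, h⟩ → i k ≠ i ⟨j.val + 1, h⟩)
  have h2 : (univ.filter (fun j : Fin m => ∀ k, k < j → i k ≠ i j)).card =
      (univ.filter (fun j : Fin m => ∃ h : j.val + 1 < m,
        ∀ k, k < ⟨j.val + 1, h⟩ → i k ≠ i ⟨j.val + 1, h⟩)).card + 1 := by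
    have h0 : (⟨0, hm⟩ : Fin m) ∈ univ.filter (fun j : Fin m => ∀ k, k < j → i k ≠ i j) := by
      refine mem_filter.2 ⟨mem_univ _, fun k hk => ?_⟩
      rw [Fin.lt_def] at hk
      exact absurd hk (Nat.not_lt_zero _)
    rw [← Finset.card_erase_add_one h0]
    congr 1
    symm
    refine Finset.card_bij (fun j hj => ⟨j.val + 1, (mem_filter.1 hj).2.1⟩) ?_ ?_ ?_
    · intro j hj
      simp only [mem_erase, mem_filter, mem_univ, true_and]
      exact ⟨by simp, (mem_filter.1 hj).2.2⟩
    · intro a _ b _ h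
      simpa [Fin.ext_iff] using h
    · rintro ⟨b, hb⟩ hbm
      simp only [mem_erase, mem_filter, mem_univ, true_and] at hbm
      cases b with
      | zero => simp at hbm
      | succ b =>
        exact ⟨⟨b, by omega⟩, mem_filter.2 ⟨mem_univ _, hb, hbm.2⟩, rfl⟩
  simp only [card_univ, Fintype.card_fin] at h1
  omega

theorem finRotate_val {m : ℕ} (hm : 0 < m) (j : Fin m) :
    finRotate m j = ⟨(j.val + 1) % m, Nat.mod_lt _ hm⟩ := by
  obtain ⟨n, rfl⟩ : ∃ n, m = n + 1 := ⟨m - 1, by omega⟩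
  ext
  rw [finRotate_succ_apply]
  simp [Fin.val_add]

theorem good_cyclic {m q : ℕ} (hm : 0 < m) (i : Fin m → Fin q)
    (hadj : ∀ j : Fin m, i j ≠ i (finRotate m j))
    (hnc : Noncrossing (kernelPartition i)) :
    ∃ k, Good (cyclicProd i) k ∧ k + m + 2 = 2 * (univ.image i).card := by
  let g : ℕ → Fin q := fun j => i ⟨j % m, Nat.mod_lt _ hm⟩
  have hgi : ∀ j : Fin m, g j = i j := fun j => by
    simp [g, Nat.mod_eq_of_lt j.2]
  have hg0 : g m = g 0 := by simp [g]
  have hstep : ∀ j : Fin m, g (j + 1) = i (finRotate m j) := fun j => by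
    rw [finRotate_val hm]
  have hP : cyclicProd i = walkProd ((List.range (m + 1)).map g) := by
    rw [walkProd_range, ← List.map_coe_finRange_eq_range, List.map_map, cyclicProd]
    congr 1
    apply List.map_congr_left
    intro j _
    simp only [Function.comp, hgi, hstep]
  have hnc' : ∀ a b c d : ℕ, a < b → b < c → c < d → d ≤ m → g a = g c → g b = g d →
      g a = g b := by
    have base : ∀ a b c d : ℕ, a < b → b < c → c < d → d < m → g a = g c → g b = g d →
      g a = g b := by
      intro a b c d h1 h2 h3 h4 e1 e2
      have := hnc ⟨a, by omega⟩ ⟨b, by omega⟩ ⟨c, by omega⟩ ⟨d, h4⟩ h1 h2 h3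
      simp only [sameBlock_kernel, ← hgi] at this
      exact this e1 e2
    intro a b c d h1 h2 h3 h4 e1 e2
    rcases Nat.lt_or_eq_of_le h4 with h | rfl
    · exact base a b c d h1 h2 h3 h e1 e2
    · rw [hg0] at e2
      rcases Nat.eq_zero_or_pos a with rfl | ha
      · exact e2.symm
      · rw [e2]
        exact (base 0 a b c ha h1 h2 h3 e2.symm e1).symm
  obtain ⟨k, hk, he⟩ := walk_good (m + 1) ((List.range (m + 1)).map g) (by simp) (by simp)
    (by
      rw [List.isChain_iff_getElem]
      intro j hj
      simp only [List.length_map, List.length_range] at hj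
      simp only [List.getElem_map, List.getElem_range]
      have := hadj ⟨j, by omega⟩
      rw [← hgi, ← hstep] at this
      exact this)
    (by
      intro a b h
      rw [List.sublist_iff_exists_fin_orderEmbedding_get_eq] at h
      obtain ⟨f, hf⟩ := h
      have lt01 : f 0 < f 1 := f.lt_iff_lt.2 (by simp [Fin.lt_def])
      have lt12 : f 1 < f 2 := f.lt_iff_lt.2 (by simp [Fin.lt_def])
      have lt23 : f 2 < f 3 := f.lt_iff_lt.2 (by simp [Fin.lt_def])
      have f0 := hf 0
      have f1 := hf 1
      have f2 := hf 2
      have f3 := hf 3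
      have hlt := (f 3).2
      simp only [List.length_map, List.length_range] at hlt
      simp at f0 f1 f2 f3
      have := hnc' (f 0) (f 1) (f 2) (f 3) lt01 lt12 lt23 (by omega) (f0.symm.trans f2)
        (f1.symm.trans f3)
      rw [f0, f1, this])
    (by
      have h1 : ((List.range (m + 1)).map g).head? = some (g 0) := by
        rw [List.range_succ_eq_map]; simp
      have h2 : ((List.range (m + 1)).map g).getLast? = some (g m) := by
        rw [List.range_succ]; simp
      rw [h1, h2, hg0])
  refine ⟨k, hP ▸ hk, ?_⟩
  have him : ((List.range (m + 1)).map g).toFinset = univ.image i := by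
    ext v
    simp only [List.mem_toFinset, List.mem_map, List.mem_range, mem_image, mem_univ, true_and]
    constructor
    · rintro ⟨a, -, rfl⟩
      exact ⟨_, rfl⟩
    · rintro ⟨a, rfl⟩
      exact ⟨a, by have := a.2; omega, hgi a⟩
  rw [him] at he
  simp at he
  omega

/-- For a cyclic sequence `(i₁,…,i_m)` in `{1,…,q}` with cyclically
adjacent entries distinct, whose kernel partition `π` is noncrossing, the Cayley
length of `σ = (i₁,i₂)(i₂,i₃)⋯(i_m,i₁)` equals `m − 2|K(π)|`, where `K(π)` is the
Kreweras complement of `π`. -/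
theorem stmt9 (m q : ℕ) (hm : 0 < m) (i : Fin m → Fin q)
    (hadj : ∀ j : Fin m, i j ≠ i (finRotate m j))
    (hnc : Noncrossing (kernelPartition i))
    (κ : Finpartition (univ : Finset (Fin m)))
    (hκ : IsKreweras (kernelPartition i) κ) :
    (cayleyLength (cyclicProd i) : ℤ) = m - 2 * κ.parts.card := by
  obtain ⟨k, hk, he⟩ := good_cyclic hm i hadj hnc
  have h2 := card_kreweras hm i hnc κ hκ
  rw [hk.length]
  omega
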